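/- Let n ≥ 1 and let R > 0, ε > 0. Let K ⊆ K′ be convex subsets of ℝ^n such that K is nonempty, K′ is contained in the closed ball of radius R centered at the origin, and every point of K′ lies at distance at most ε from K. Then the Lebesgue measure of K′ ∖ K is at most vol(B̄(0, R+ε)) − vol(B̄(0, R)), the difference of the Lebesgue measures of the closed balls of radii R+ε and R centered at the origin. -/

import Mathlib

open MeasureTheory Set Filter Topology Metric
open scoped NNReal ENNReal RealInnerProductSpace

section aux

variable {E : Type*} [NormedAddCommGroup E] [InnerProductSpace ℝ E]

lemma aux_hasFDerivAt_norm {x : E} (hx : x ≠ 0) :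
    HasFDerivAt (fun y : E => ‖y‖) (‖x‖⁻¹ • innerSL ℝ x) x := by
  have h1 : HasFDerivAt (fun y : E => ‖y‖ ^ 2) (2 • innerSL ℝ x) x := by
    simpa using (hasFDerivAt_id x).norm_sq
  have hx' : ‖x‖ ≠ 0 := norm_ne_zero_iff.2 hx
  have h2 := h1.sqrt (pow_ne_zero 2 hx')
  simp only [Real.sqrt_sq (norm_nonneg _)] at h2
  convert! h2 using 1
  ext h
  simp
  field_simp

/-- g at level t -/
noncomputable def auxG (p : E → E) (t : ℝ) (x : E) : E :=
  p x + (t * ‖x - p x‖⁻¹) • (x - p x)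

/-- nonexpansiveness from the variational inequality -/
lemma aux_nonexp {x y a b : E} (h1 : ⟪x - a, b - a⟫ ≤ 0) (h2 : ⟪y - b, a - b⟫ ≤ 0) :
    ‖a - b‖ ≤ ‖x - y‖ := by
  have h3 : ⟪x - y, a - b⟫ = ‖a - b‖ ^ 2 - ⟪x - a, b - a⟫ - ⟪y - b, a - b⟫ := by
    rw [← real_inner_self_eq_norm_sq]
    simp only [inner_sub_left, inner_sub_right]
    ring
  have h4 := real_inner_le_norm (x - y) (a - b)
  by_contra! h
  have : 0 ≤ ‖x - y‖ := norm_nonneg _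
  nlinarith

variable {K : Set E} {p : E → E} (hp : ∀ x, p x ∈ K)
  (hv : ∀ x, ∀ w ∈ K, ⟪x - p x, w - p x⟫ ≤ 0)

include hp hv

lemma aux_lip : LipschitzWith 1 p := by
  refine LipschitzWith.of_dist_le_mul fun x y => ?_
  simp only [NNReal.coe_one, one_mul, dist_eq_norm]
  exact aux_nonexp (hv x _ (hp y)) (hv y _ (hp x))

lemma aux_uniq {x a : E} (ha : a ∈ K) (h : ∀ w ∈ K, ⟪x - a, w - a⟫ ≤ 0) : p x = a := by
  have := aux_nonexp (hv x _ ha) (h _ (hp x))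
  simpa [sub_eq_zero] using this

lemma aux_ray (x : E) {s : ℝ} (hs : -1 ≤ s) : p (x + s • (x - p x)) = p x := by
  refine aux_uniq hp hv (hp x) fun w hw => ?_
  have : x + s • (x - p x) - p x = (1 + s) • (x - p x) := by module
  rw [this, inner_smul_left]
  exact mul_nonpos_of_nonneg_of_nonpos (by simpa using (by linarith : 0 ≤ 1 + s)) (hv x w hw)

/-- the level projection is nonexpansive -/
lemma aux_level {t : ℝ} (ht : 0 < t) {x y : E} (hx : t ≤ ‖x - p x‖) (hy : t ≤ ‖y - p y‖) :
    ‖auxG p t x - auxG p t y‖ ≤ ‖x - y‖ := by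
  have key : ∀ x y : E, t ≤ ‖x - p x‖ → t ≤ ‖y - p y‖ →
      ⟪x - auxG p t x, auxG p t y - auxG p t x⟫ ≤ 0 := by
    intro x y hx hy
    have dx : 0 < ‖x - p x‖ := ht.trans_le hx
    have dy : 0 < ‖y - p y‖ := ht.trans_le hy
    have e1 : x - auxG p t x = (1 - t * ‖x - p x‖⁻¹) • (x - p x) := by
      simp only [auxG]; module
    have hc : 0 ≤ 1 - t * ‖x - p x‖⁻¹ := by
      rw [sub_nonneg, ← div_eq_mul_inv, div_le_one dx]; exact hx
    rw [e1, inner_smul_left]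
    refine mul_nonpos_of_nonneg_of_nonpos (by simpa using hc) ?_
    have e2 : auxG p t y - auxG p t x = (p y - p x) + (t * ‖y - p y‖⁻¹) • (y - p y)
        - (t * ‖x - p x‖⁻¹) • (x - p x) := by simp only [auxG]; module
    rw [e2, inner_sub_right, inner_add_right, inner_smul_right, inner_smul_right,
      real_inner_self_eq_norm_sq]
    have h1 := hv x _ (hp y)
    have h2 := real_inner_le_norm (x - p x) (y - p y)
    have h3 : t * ‖y - p y‖⁻¹ * ⟪x - p x, y - p y⟫ ≤ t * ‖x - p x‖ := by
      calc _ ≤ t * ‖y - p y‖⁻¹ * (‖x - p x‖ * ‖y - p y‖) := by gcongr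
        _ = _ := by field_simp
    have h4 : t * ‖x - p x‖⁻¹ * ‖x - p x‖ ^ 2 = t * ‖x - p x‖ := by field_simp
    linarith
  exact aux_nonexp (key x y hx hy) (key y x hy hx)

omit hp hv in
lemma aux_level2 {s t : ℝ} {x : E} (hx : x - p x ≠ 0) :
    ‖auxG p t x - auxG p s x‖ ≤ |t - s| := by
  have : auxG p t x - auxG p s x = ((t - s) * ‖x - p x‖⁻¹) • (x - p x) := by
    simp only [auxG]; module
  rw [this, norm_smul, Real.norm_eq_abs, abs_mul, abs_inv, abs_norm, mul_assoc,
    inv_mul_cancel₀ (norm_ne_zero_iff.2 hx), mul_one]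

lemma aux_lipG {R : ℝ} (hKR : ∀ x ∈ K, ‖x‖ ≤ R) :
    LipschitzOnWith 2 (fun x => auxG p (‖x‖ - R) x) {x | R < ‖x‖} := by
  have hd : ∀ x, ‖x‖ - R ≤ ‖x - p x‖ := fun x => by
    have := norm_sub_norm_le x (p x)
    have := hKR _ (hp x)
    linarith
  have key : ∀ x y : E, R < ‖x‖ → ‖x‖ ≤ ‖y‖ →
      dist (auxG p (‖x‖ - R) x) (auxG p (‖y‖ - R) y) ≤ 2 * dist x y := by
    intro x y hx hxy
    have h1 : ‖auxG p (‖x‖ - R) x - auxG p (‖x‖ - R) y‖ ≤ ‖x - y‖ :=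
      aux_level hp hv (by linarith) (hd x) (by linarith [hd y])
    have h2 : ‖auxG p (‖x‖ - R) y - auxG p (‖y‖ - R) y‖ ≤ |(‖x‖ - R) - (‖y‖ - R)| :=
      aux_level2 (norm_pos_iff.1 (by linarith [hd y]))
    have h3 : |(‖x‖ - R) - (‖y‖ - R)| ≤ ‖x - y‖ := by
      rw [sub_sub_sub_cancel_right]; exact abs_norm_sub_norm_le x y
    have := dist_triangle (auxG p (‖x‖ - R) x) (auxG p (‖x‖ - R) y) (auxG p (‖y‖ - R) y)
    simp only [dist_eq_norm] at this ⊢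
    linarith
  refine LipschitzOnWith.of_dist_le_mul fun x hx y hy => ?_
  rcases le_total ‖x‖ ‖y‖ with h | h
  · exact key x y hx h
  · rw [dist_comm, dist_comm x y]; exact key y x hy h

lemma aux_Q {z : E} {Q : E →L[ℝ] E} (hQ : HasFDerivAt p Q z) :
    (∀ h, ⟪z - p z, Q h⟫ = 0) ∧ Q (z - p z) = 0 ∧ ∀ h, ‖Q h‖ ≤ ‖h‖ := by
  refine ⟨?_, ?_, ?_⟩
  · have h1 : HasFDerivAt (fun x => ⟪z - p z, p x⟫) ((innerSL ℝ (z - p z)).comp Q) z :=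
      (innerSL ℝ (z - p z)).hasFDerivAt.comp z hQ
    have h2 : IsLocalMax (fun x => ⟪z - p z, p x⟫) z := by
      refine Filter.Eventually.of_forall fun x => ?_
      have := hv z _ (hp x)
      rw [inner_sub_right] at this
      simpa using this
    intro h
    exact DFunLike.congr_fun (h2.hasFDerivAt_eq_zero h1) h
  · have hl : HasDerivAt (fun s : ℝ => z + s • (z - p z)) (z - p z) 0 := by
      simpa using ((hasDerivAt_id (0 : ℝ)).smul_const (z - p z)).const_add z
    have h1 : HasDerivAt (fun s : ℝ => p (z + s • (z - p z))) (Q (z - p z)) 0 :=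
      HasFDerivAt.comp_hasDerivAt (l := p) (f := fun s : ℝ => z + s • (z - p z)) 0
        (by simpa using hQ) hl
    have h2 : HasDerivAt (fun s : ℝ => p (z + s • (z - p z))) 0 0 := by
      refine (hasDerivAt_const (0 : ℝ) (p z)).congr_of_eventuallyEq ?_
      filter_upwards [lt_mem_nhds (show (-1 : ℝ) < 0 by norm_num)] with s hs
      exact aux_ray hp hv z hs.le
    exact h1.unique h2
  · intro h
    have := hQ.le_of_lipschitz (aux_lip hp hv)
    calc ‖Q h‖ ≤ ‖Q‖ * ‖h‖ := Q.le_opNorm h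
      _ ≤ 1 * ‖h‖ := by gcongr; simpa using this
      _ = _ := one_mul _

omit hp hv in
lemma aux_det [FiniteDimensional ℝ E] [Nontrivial E] (M : E →ₗ[ℝ] E) (hM : ∀ h, ‖M h‖ ≤ ‖h‖) :
    |LinearMap.det M| ≤ 1 := by
  borelize E
  let μ : Measure E := Measure.addHaar
  have h1 := Measure.addHaar_image_linearMap μ M (closedBall 0 1)
  have h2 : μ (M '' closedBall 0 1) ≤ μ (closedBall 0 1) := by
    refine measure_mono ?_
    rintro _ ⟨x, hx, rfl⟩
    simp only [mem_closedBall, dist_zero_right] at hx ⊢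
    exact (hM x).trans hx
  rw [h1] at h2
  have h3 : μ (closedBall 0 1) ≠ 0 := (measure_closedBall_pos μ _ one_pos).ne'
  have h4 : μ (closedBall 0 1) ≠ ∞ := measure_closedBall_lt_top.ne
  have h5 : ENNReal.ofReal |LinearMap.det M| ≤ 1 := by
    rw [← ENNReal.mul_le_mul_iff_left h3 h4]; simpa using h2
  simpa using h5

lemma aux_deriv [FiniteDimensional ℝ E] [Nontrivial E] {R : ℝ} (hR : 0 < R)
    (hKR : ∀ x ∈ K, ‖x‖ ≤ R) {z : E} (hz : R < ‖z‖) (hQ : DifferentiableAt ℝ p z) :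
    ∃ D : E →L[ℝ] E, HasFDerivAt (fun x => auxG p (‖x‖ - R) x) D z ∧ |D.det| ≤ 1 := by
  obtain ⟨Q, hQ⟩ := hQ
  obtain ⟨q1, q2, q3⟩ := aux_Q hp hv hQ
  have hd : ‖z‖ - R ≤ ‖z - p z‖ := by
    have := norm_sub_norm_le z (p z)
    have := hKR _ (hp z)
    linarith
  have hd0 : 0 < ‖z - p z‖ := by linarith
  have hz0 : 0 < ‖z‖ := by linarith
  have hsub : HasFDerivAt (fun x => x - p x) (ContinuousLinearMap.id ℝ E - Q) z :=
    (hasFDerivAt_id z).sub hQ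
  have hn := (aux_hasFDerivAt_norm (norm_pos_iff.1 hd0)).comp z hsub
  have hni := (hasDerivAt_inv hd0.ne').comp_hasFDerivAt z hn
  have hnz := (aux_hasFDerivAt_norm (norm_pos_iff.1 hz0)).sub_const R
  have hc := hnz.mul hni
  have hg := hQ.add (hc.smul hsub)
  refine ⟨_, hg, ?_⟩
  set d := ‖z - p z‖ with hdd
  set u : E := d⁻¹ • (z - p z) with hu
  have hud : z - p z = d • u := by rw [hu, smul_smul, mul_inv_cancel₀ hd0.ne', one_smul]
  have hun : ‖u‖ = 1 := by
    rw [hu, norm_smul, norm_inv, norm_norm, inv_mul_cancel₀ hd0.ne']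
  have hQu : Q u = 0 := by rw [hu, map_smul, q2, smul_zero]
  have huQ : ∀ h, ⟪u, Q h⟫ = 0 := fun h => by rw [hu, inner_smul_left, q1]; simp
  have huu : ⟪u, u⟫ = 1 := by rw [real_inner_self_eq_norm_sq, hun]; norm_num
  set s : ℝ := (‖z‖ - R) * d⁻¹ with hs
  have hs0 : 0 ≤ s := mul_nonneg (by linarith) (inv_nonneg.2 hd0.le)
  have hs1 : s ≤ 1 := by rw [hs, ← div_eq_mul_inv, div_le_one hd0]; exact hd
  let M : E →ₗ[ℝ] E := (1 - s) • (Q : E →ₗ[ℝ] E) + s • LinearMap.id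
    + (1 - s) • ((innerSL ℝ u : E →L[ℝ] ℝ) : E →ₗ[ℝ] ℝ).smulRight u
  let f : E →ₗ[ℝ] ℝ := ((innerSL ℝ (‖z‖⁻¹ • z - u) : E →L[ℝ] ℝ) : E →ₗ[ℝ] ℝ)
  have hM : ∀ h, ‖M h‖ ≤ ‖h‖ := by
    intro h
    set a := ⟪u, h⟫ with ha
    set w := h - a • u with hw
    have hhw : h = w + a • u := by rw [hw]; abel
    have huw : ⟪u, w⟫ = 0 := by rw [hw, inner_sub_right, inner_smul_right, huu, ← ha]; ring
    have e1 : M h = ((1 - s) • Q w + s • w) + a • u := by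
      have : Q h = Q w := by rw [hhw, map_add, map_smul, hQu, smul_zero, add_zero]
      simp only [M, LinearMap.add_apply, LinearMap.smul_apply, ContinuousLinearMap.coe_coe, this,
        LinearMap.id_apply, LinearMap.smulRight_apply, innerSL_apply_apply, ← ha]
      rw [hw]
      module
    have e2 : ‖(1 - s) • Q w + s • w‖ ≤ ‖w‖ := by
      calc _ ≤ ‖(1 - s) • Q w‖ + ‖s • w‖ := norm_add_le _ _
        _ = (1 - s) * ‖Q w‖ + s * ‖w‖ := by
          rw [norm_smul, norm_smul, Real.norm_of_nonneg hs0, Real.norm_of_nonneg (by linarith)]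
        _ ≤ (1 - s) * ‖w‖ + s * ‖w‖ := by
          have := q3 w
          have : 0 ≤ 1 - s := by linarith
          gcongr
        _ = _ := by ring
    have o1 : ⟪(1 - s) • Q w + s • w, a • u⟫ = 0 := by
      rw [real_inner_comm, inner_smul_left, inner_add_right, inner_smul_right, inner_smul_right,
        huQ, huw]; simp
    have o2 : ⟪w, a • u⟫ = 0 := by rw [real_inner_comm, inner_smul_left, huw]; simp
    have n1 := norm_add_sq_eq_norm_sq_add_norm_sq_real o1
    have n2 := norm_add_sq_eq_norm_sq_add_norm_sq_real o2
    rw [← e1] at n1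
    rw [← hhw] at n2
    have := norm_nonneg ((1 - s) • Q w + s • w)
    have := norm_nonneg h
    by_contra! hcon
    nlinarith
  have hMu : M u = u := by
    simp only [M, LinearMap.add_apply, LinearMap.smul_apply, ContinuousLinearMap.coe_coe, hQu,
      LinearMap.id_apply, LinearMap.smulRight_apply, innerSL_apply_apply, huu]
    module
  have hdet : |LinearMap.det (M ∘ₗ LinearMap.transvection f u)| ≤ 1 := by
    rw [LinearMap.det_comp, LinearMap.transvection.det, abs_mul]
    refine mul_le_one₀ (aux_det M hM) (abs_nonneg _) ?_
    have : 1 + f u = ⟪‖z‖⁻¹ • z, u⟫ := by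
      simp only [f, ContinuousLinearMap.coe_coe, innerSL_apply_apply, inner_sub_left, huu]; ring
    rw [this]
    refine (abs_real_inner_le_norm _ _).trans ?_
    rw [hun, norm_smul, norm_inv, norm_norm, inv_mul_cancel₀ hz0.ne', one_mul]
  refine le_of_eq_of_le ?_ hdet
  rw [ContinuousLinearMap.det]
  congr 2
  ext1 h
  simp only [LinearMap.comp_apply, LinearMap.transvection.apply, map_add, map_smul, hMu]
  change Q h + (s • (h - Q h) + ((‖z‖ - R) * (-(d ^ 2)⁻¹ * (d⁻¹ * ⟪z - p z, h - Q h⟫))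
    + d⁻¹ * (‖z‖⁻¹ * ⟪z, h⟫)) • (z - p z)) = ((1 - s) • Q h + s • h + (1 - s) • ⟪u, h⟫ • u)
    + ⟪‖z‖⁻¹ • z - u, h⟫ • u
  rw [hud, inner_smul_left, inner_sub_right, huQ, inner_sub_left,
    inner_smul_left (𝕜 := ℝ) z h]
  have e : ((‖z‖ - R) * (-(d ^ 2)⁻¹ * (d⁻¹ * (d * (⟪u, h⟫ - 0))))
    + d⁻¹ * (‖z‖⁻¹ * ⟪z, h⟫)) * d = -s * ⟪u, h⟫ + ‖z‖⁻¹ * ⟪z, h⟫ := by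
    rw [hs]; field_simp; ring
  rw [smul_smul]
  simp only [conj_trivial]
  rw [e]
  module

end aux

lemma aux_main {n : ℕ} (hn : 1 ≤ n) (R ε : ℝ) (hR : 0 < R) (hε : 0 < ε)
    (K : Set (EuclideanSpace ℝ (Fin n))) (hKc : IsClosed K) (hKconv : Convex ℝ K)
    (hKne : K.Nonempty) (hKR : ∀ x ∈ K, ‖x‖ ≤ R) :
    volume {x | 0 < infDist x K ∧ infDist x K ≤ ε} ≤
      volume (closedBall (0 : EuclideanSpace ℝ (Fin n)) (R + ε) \ closedBall 0 R) := by
  have : Nonempty (Fin n) := ⟨⟨0, hn⟩⟩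
  choose p hp hpd using fun x => exists_norm_eq_iInf_of_complete_convex hKne hKc.isComplete hKconv x
  have hv : ∀ x, ∀ w ∈ K, ⟪x - p x, w - p x⟫ ≤ 0 := fun x =>
    (norm_eq_iInf_iff_real_inner_le_zero hKconv (hp x)).1 (hpd x)
  have hinf : ∀ x, infDist x K = ‖x - p x‖ := by
    intro x
    rw [hpd x, infDist_eq_iInf]
    simp only [dist_eq_norm]
  set g : EuclideanSpace ℝ (Fin n) → EuclideanSpace ℝ (Fin n) := fun x => auxG p (‖x‖ - R) x with hg
  set S : Set (EuclideanSpace ℝ (Fin n)) := closedBall 0 (R + ε) \ closedBall 0 R with hS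
  have hSm : MeasurableSet S := measurableSet_closedBall.diff measurableSet_closedBall
  have hSR : ∀ x ∈ S, R < ‖x‖ := fun x hx => by simpa using hx.2
  have hsurj : {x | 0 < infDist x K ∧ infDist x K ≤ ε} ⊆ g '' S := by
    rintro y ⟨h0, h1⟩
    rw [hinf] at h0 h1
    set t := ‖y - p y‖ with ht
    have hy : ‖y‖ ≤ R + t := by
      have := norm_sub_norm_le y (p y)
      have := hKR _ (hp y)
      linarith
    obtain ⟨s, hs, hs'⟩ : ∃ s ∈ Icc (0 : ℝ) ((R + t + ‖y‖) / t),
        ‖y + s • (y - p y)‖ = R + t := by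
      have hcont : ContinuousOn (fun s : ℝ => ‖y + s • (y - p y)‖)
        (Icc (0 : ℝ) ((R + t + ‖y‖) / t)) := by fun_prop
      refine intermediate_value_Icc (by positivity) hcont ⟨by simpa using hy, ?_⟩
      have a1 := norm_sub_norm_le (((R + t + ‖y‖) / t) • (y - p y)) (-y)
      rw [norm_smul, Real.norm_of_nonneg (by positivity), ← ht, div_mul_cancel₀ _ h0.ne', norm_neg,
        sub_neg_eq_add, add_comm _ y] at a1
      linarith
    have hpz := aux_ray hp hv y (s := s) (by linarith [hs.1])
    refine ⟨y + s • (y - p y), ⟨?_, ?_⟩, ?_⟩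
    · rw [mem_closedBall, dist_zero_right, hs']; linarith
    · rw [mem_closedBall, dist_zero_right, hs']; linarith
    · have e : y + s • (y - p y) - p y = (1 + s) • (y - p y) := by module
      have h1s : 0 < 1 + s := by linarith [hs.1]
      simp only [hg, auxG, hpz, hs', e, norm_smul, Real.norm_of_nonneg h1s.le, ← ht]
      rw [smul_smul]
      have : (R + t - R) * ((1 + s) * t)⁻¹ * (1 + s) = 1 := by
        field_simp; ring
      rw [this]; module
  set A := S ∩ {x | DifferentiableAt ℝ p x} with hA
  have hAm : MeasurableSet A := hSm.inter (measurableSet_of_differentiableAt ℝ p)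
  have hN : volume (S \ {x | DifferentiableAt ℝ p x}) = 0 := by
    refine measure_mono_null ?_ (ae_iff.1 (aux_lip hp hv).ae_differentiableAt)
    intro x hx; exact hx.2
  have hgN : volume (g '' (S \ {x | DifferentiableAt ℝ p x})) = 0 := by
    have hL : LipschitzOnWith 2 g (S \ {x | DifferentiableAt ℝ p x}) :=
      (aux_lipG hp hv hKR).mono fun x hx => hSR x hx.1
    let μ : Measure (EuclideanSpace ℝ (Fin n)) :=
      Measure.hausdorffMeasure (Module.finrank ℝ (EuclideanSpace ℝ (Fin n)))
    have h1 : μ (S \ {x | DifferentiableAt ℝ p x}) = 0 :=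
      Measure.absolutelyContinuous_isAddHaarMeasure μ volume hN
    have h2 : μ (g '' (S \ {x | DifferentiableAt ℝ p x})) ≤ _ :=
      hL.hausdorffMeasure_image_le (Nat.cast_nonneg _)
    have h3 : μ (g '' (S \ {x | DifferentiableAt ℝ p x})) = 0 := by
      refine le_antisymm (h2.trans ?_) zero_le
      change _ * μ _ ≤ 0
      rw [h1, mul_zero]
    exact Measure.absolutelyContinuous_isAddHaarMeasure volume μ h3
  have hgA : volume (g '' A) ≤ volume A := by
    choose! D hD hdet using fun x (hx : x ∈ A) =>
      aux_deriv hp hv hR hKR (hSR x hx.1) hx.2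
    calc volume (g '' A) ≤ ∫⁻ x in A, ENNReal.ofReal |(D x).det| :=
        addHaar_image_le_lintegral_abs_det_fderiv volume hAm
          fun x hx => (hD x hx).hasFDerivWithinAt
      _ ≤ ∫⁻ x in A, 1 := by
        refine setLIntegral_mono' hAm fun x hx => ?_
        simpa using hdet x hx
      _ = volume A := by simp
  calc _ ≤ volume (g '' S) := measure_mono hsurj
    _ = volume (g '' A ∪ g '' (S \ {x | DifferentiableAt ℝ p x})) := by
      rw [← image_union, hA, inter_union_sdiff]
    _ ≤ volume (g '' A) + volume (g '' (S \ {x | DifferentiableAt ℝ p x})) := measure_union_le _ _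
    _ ≤ volume A := by rw [hgN, add_zero]; exact hgA
    _ ≤ volume S := measure_mono inter_subset_left


/-- if `K ⊆ K'` are convex subsets of `ℝ^n`, `K` nonempty, `K'` contained in
the closed ball of radius `R` and within distance `ε` of `K`, then the volume of `K' \ K`
is at most the difference of the volumes of the balls of radii `R + ε` and `R`. -/
theorem stmt8 {n : ℕ} (hn : 1 ≤ n) (R ε : ℝ) (hR : 0 < R) (hε : 0 < ε)
    (K K' : Set (EuclideanSpace ℝ (Fin n)))
    (hKK' : K ⊆ K') (hKconv : Convex ℝ K) (hK'conv : Convex ℝ K')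
    (hKne : K.Nonempty)
    (hK'R : K' ⊆ Metric.closedBall 0 R)
    (hK'ε : ∀ x ∈ K', Metric.infDist x K ≤ ε) :
    MeasureTheory.volume (K' \ K) ≤
      MeasureTheory.volume (Metric.closedBall (0 : EuclideanSpace ℝ (Fin n)) (R + ε)) -
        MeasureTheory.volume (Metric.closedBall (0 : EuclideanSpace ℝ (Fin n)) R) := by

  have hcl : ∀ x ∈ closure K, ‖x‖ ≤ R := fun x hx => by
    simpa using closure_minimal (hKK'.trans hK'R) isClosed_closedBall hx
  have h := aux_main hn R ε hR hε (closure K) isClosed_closure hKconv.closure hKne.closure hcl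
  rw [measure_sdiff (closedBall_subset_closedBall (by linarith))
    measurableSet_closedBall.nullMeasurableSet measure_closedBall_lt_top.ne] at h
  refine le_trans ?_ h
  have hsub : K' \ K ⊆ {x | 0 < infDist x (closure K) ∧ infDist x (closure K) ≤ ε} ∪
      frontier K := by
    rintro x ⟨hx, hxK⟩
    by_cases hc : x ∈ closure K
    · exact Or.inr ⟨hc, fun hi => hxK (interior_subset hi)⟩
    · left
      refine ⟨(isClosed_closure.notMem_iff_infDist_pos hKne.closure).1 hc, ?_⟩
      rw [infDist_closure]
      exact hK'ε x hx
  refine (measure_mono hsub).trans ((measure_union_le _ _).trans ?_)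
  rw [hKconv.addHaar_frontier volume, add_zero]
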